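/- Let q : Y → X be a pure quotient map from a standard space Y onto a Hausdorff space X. Then the following are equivalent: (1) every point of X is a k-point; (2) X is a Fréchet–Urysohn space; (3) there exist a standard space Z and a closed quotient map from Z onto X; (4) there exist a standard space Z and an irreducible closed quotient map from Z onto X. -/

import Mathlib

open Filter Topology Set TopologicalSpace

universe u v w

/-- A quotient map: surjective, continuous, and a set is open iff its preimage is open. -/
def IsQuotMap {Y : Type u} {X : Type v} [TopologicalSpace Y] [TopologicalSpace X]
    (q : Y → X) : Prop :=
  Function.Surjective q ∧ Continuous q ∧ ∀ s : Set X, IsOpen s ↔ IsOpen (q ⁻¹' s)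

/-- An irreducible map: no proper closed subset of the domain maps onto all of `X`. -/
def IsIrreducibleMap {Y : Type u} {X : Type v} [TopologicalSpace Y] (q : Y → X) : Prop :=
  ∀ V : Set Y, IsClosed V → q '' V = Set.univ → V = Set.univ

/-- A pure quotient map. -/
def IsPureQuotMap {Y : Type u} {X : Type v} [TopologicalSpace Y] [TopologicalSpace X]
    (q : Y → X) : Prop :=
  IsQuotMap q ∧
    ∃ D : Set Y, Dense D ∧ Set.InjOn q D ∧
      ∀ (ι : Type w) (_ : Preorder ι) (_ : Nonempty ι), IsDirected ι (· ≤ ·) →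
        ∀ d e : ι → Y, (∀ i, d i ∈ D) → (∀ i, q (d i) = q (e i)) →
          Filter.Tendsto d Filter.atTop (Filter.cocompact Y) →
          Filter.Tendsto e Filter.atTop (Filter.cocompact Y)

/-- `x` is a k-point. -/
def IsKPoint {X : Type v} [TopologicalSpace X] (x : X) : Prop :=
  ∀ E : Set X, x ∈ closure E → ∃ K : Set X, IsCompact K ∧ x ∈ closure (E ∩ K)

/-- A full subset: closed and mapping onto all of `X`. -/
def IsFull {Y : Type u} {X : Type v} [TopologicalSpace Y] (q : Y → X) (W : Set Y) : Prop :=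
  IsClosed W ∧ q '' W = Set.univ

/-- A minimal full subset. -/
def IsMinFull {Y : Type u} {X : Type v} [TopologicalSpace Y] (q : Y → X) (W : Set Y) : Prop :=
  IsFull q W ∧ ∀ Z ⊆ W, IsFull q Z → Z = W

/-- `y` is a singleton fibre of `q`. -/
def SingletonFibre {Y : Type u} {X : Type v} (q : Y → X) (y : Y) : Prop :=
  q ⁻¹' {q y} = {y}

/-- A sequentially dense subset of `X`. -/
def SeqDense {X : Type v} [TopologicalSpace X] (E : Set X) : Prop :=
  ∀ x : X, ∃ u : ℕ → X, (∀ n, u n ∈ E) ∧ Filter.Tendsto u Filter.atTop (nhds x)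

/-- A point of compact type. -/
def CompactType {X : Type v} [TopologicalSpace X] (x : X) : Prop :=
  ∃ K : Set X, IsCompact K ∧
    ∀ u : ℕ → X, Filter.Tendsto u Filter.atTop (nhds x) → ∀ᶠ n in Filter.atTop, u n ∈ K

/-- Convergence of a sequence of closed sets in the Fell topology. -/
def FellConv {Y : Type u} [TopologicalSpace Y] (F : ℕ → Set Y) (L : Set Y) : Prop :=
  (∀ U : Set Y, IsOpen U → (U ∩ L).Nonempty → ∀ᶠ n in Filter.atTop, (F n ∩ U).Nonempty) ∧
  (∀ K : Set Y, IsCompact K → K ∩ L = ∅ → ∀ᶠ n in Filter.atTop, F n ∩ K = ∅)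

/-- Membership in `C₀(Y)⁺`: continuous, nonnegative, vanishing at infinity. -/
def C0Plus {Y : Type u} [TopologicalSpace Y] (f : Y → ℝ) : Prop :=
  Continuous f ∧ (∀ y, 0 ≤ f y) ∧ ∀ ε : ℝ, 0 < ε → IsCompact {y | ε ≤ f y}

/-- `f^♯(y) = sup { f w : q w = q y }`. -/
noncomputable def fSharp {Y : Type u} {X : Type v} (q : Y → X) (f : Y → ℝ) (y : Y) : ℝ :=
  sSup (f '' (q ⁻¹' {q y}))

/-- `f^♭(x) = sup { f y : y ∈ q⁻¹(x) }`. -/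
noncomputable def fFlat {Y : Type u} {X : Type v} (q : Y → X) (f : Y → ℝ) (x : X) : ℝ :=
  sSup (f '' (q ⁻¹' {x}))

/-- Property (a). -/
def PropertyA {X : Type v} [TopologicalSpace X] (E : Set X) : Prop :=
  ∀ (x : ℕ → X) (x₀ : X), (∀ m, x m ∈ E) → Function.Injective x →
    Filter.Tendsto x Filter.atTop (nhds x₀) →
    ∃ φ : ℕ → ℕ, StrictMono φ ∧
      ∀ z : ℕ → ℕ → X, (∀ n, Filter.Tendsto (z n) Filter.atTop (nhds (x (φ n)))) →
        ∃ k : ℕ → ℕ, IsCompact (closure {p : X | ∃ n j, k n ≤ j ∧ z n j = p})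

/-- Property (b). -/
def PropertyB {X : Type v} [TopologicalSpace X] (E : Set X) : Prop :=
  ∀ (x : ℕ → X) (x₀ : X), Function.Injective x →
    Filter.Tendsto x Filter.atTop (nhds x₀) →
    ∃ φ : ℕ → ℕ, StrictMono φ ∧
      ∃ z : ℕ → ℕ → X, (∀ n j, z n j ∈ E) ∧
        (∀ n, Filter.Tendsto (z n) Filter.atTop (nhds (x (φ n)))) ∧
        ∀ js : ℕ → ℕ, Filter.Tendsto (fun n => z n (js n)) Filter.atTop (nhds x₀)

lemma aux_secondCountable {A : Type*} {B : Type*} [TopologicalSpace A] [CompactSpace A]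
    [SecondCountableTopology A] [TopologicalSpace B] [T2Space B] (f : A → B)
    (hf : Continuous f) (hs : Function.Surjective f) : SecondCountableTopology B := by
  classical
  have hcl : IsClosedMap f := hf.isClosedMap
  set b := countableBasis A with hb
  have hbc : b.Countable := countable_countableBasis A
  have hbas : IsTopologicalBasis b := isBasis_countableBasis A
  let S : Set (Set (Set A)) := {s | s.Finite ∧ s ⊆ b}
  have hS : S.Countable := countable_ofPred_finite_subset hbc
  have hopen : ∀ s ∈ S, IsOpen (f '' (⋃₀ s)ᶜ)ᶜ := by
    intro s hs'
    have : IsOpen (⋃₀ s) := isOpen_sUnion fun t ht => hbas.isOpen (hs'.2 ht)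
    exact (hcl _ this.isClosed_compl).isOpen_compl
  have hB : IsTopologicalBasis ((fun s : Set (Set A) => (f '' (⋃₀ s)ᶜ)ᶜ) '' S) := by
    refine isTopologicalBasis_of_isOpen_of_nhds ?_ ?_
    · rintro _ ⟨s, hs', rfl⟩
      exact hopen s hs'
    · intro x U hxU hU
      have hK : IsCompact (f ⁻¹' {x}) := (isClosed_singleton.preimage hf).isCompact
      have h1 : ∀ a ∈ f ⁻¹' {x}, ∃ t ∈ b, a ∈ t ∧ t ⊆ f ⁻¹' U := by
        intro a ha
        have ha' : f a = x := ha
        exact hbas.exists_subset_of_mem_open (show a ∈ f ⁻¹' U by simp [ha', hxU])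
          (hU.preimage hf)
      choose! g hg1 hg2 hg3 using h1
      obtain ⟨t, ht, htc⟩ := hK.elim_nhds_subcover g
        (fun a ha => (hbas.isOpen (hg1 a ha)).mem_nhds (hg2 a ha))
      refine ⟨_, ⟨g '' (t : Set A), ⟨t.finite_toSet.image g, ?_⟩, rfl⟩, ?_, ?_⟩
      · rintro _ ⟨a, ha, rfl⟩
        exact hg1 a (ht a ha)
      · rintro ⟨a, ha, hax⟩
        apply ha
        have := htc (show a ∈ f ⁻¹' {x} from hax)
        simpa using this
      · intro y hy
        obtain ⟨a, rfl⟩ := hs y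
        by_contra hyU
        apply hy
        refine ⟨a, ?_, rfl⟩
        rintro ⟨_, ⟨c, hc, rfl⟩, hac⟩
        exact hyU (hg3 c (ht c hc) hac)
  exact hB.secondCountableTopology (hS.image _)

lemma aux_kpoint_of_frechet {X : Type*} [TopologicalSpace X]
    (h : ∀ (A : Set X) (x : X), x ∈ closure A →
        ∃ u : ℕ → X, (∀ n, u n ∈ A) ∧ Filter.Tendsto u Filter.atTop (nhds x)) (x : X) :
    IsKPoint x := by
  intro E hx
  obtain ⟨u, hu, hux⟩ := h E x hx
  refine ⟨_, hux.isCompact_insert_range, ?_⟩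
  exact mem_closure_of_tendsto hux (Eventually.of_forall fun n => ⟨hu n, by simp⟩)

lemma aux_frechet_of_closed {Z X : Type*} [MetricSpace Z] [TopologicalSpace X] (p : Z → X)
    (hp : IsQuotMap p) (hc : IsClosedMap p) (A : Set X) (x : X) (hx : x ∈ closure A) :
    ∃ u : ℕ → X, (∀ n, u n ∈ A) ∧ Filter.Tendsto u Filter.atTop (nhds x) := by
  have h1 : A ⊆ p '' closure (p ⁻¹' A) := by
    intro a ha
    obtain ⟨z, rfl⟩ := hp.1 a
    exact ⟨z, subset_closure ha, rfl⟩
  obtain ⟨z, hz, rfl⟩ := closure_minimal h1 (hc _ isClosed_closure) hx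
  obtain ⟨u, hu, huz⟩ := mem_closure_iff_seq_limit.1 hz
  exact ⟨fun n => p (u n), hu, (hp.2.1.tendsto z).comp huz⟩

lemma aux_komega {Y X : Type*} [TopologicalSpace Y] [TopologicalSpace X] [T2Space X]
    (q : Y → X) (hq : IsQuotMap q) (K : CompactExhaustion Y) (F : Set X)
    (hF : ∀ n, IsClosed (F ∩ q '' K n)) : IsClosed F := by
  have : IsClosed (q ⁻¹' F) := by
    refine isClosed_of_closure_subset fun y hy => ?_
    obtain ⟨n, hn⟩ := K.exists_mem_nhds y
    have h2 : y ∈ closure (q ⁻¹' F ∩ K n) := by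
      rw [mem_closure_iff_nhds] at hy ⊢
      intro t ht
      obtain ⟨z, hz, hz'⟩ := hy _ (inter_mem ht hn)
      exact ⟨z, hz.1, hz', hz.2⟩
    have h3 : q ⁻¹' F ∩ K n ⊆ q ⁻¹' (F ∩ q '' K n) := fun z hz => ⟨hz.1, z, hz.2, rfl⟩
    exact (closure_minimal h3 ((hF n).preimage hq.2.1) h2).1
  rw [← isOpen_compl_iff, hq.2.2, preimage_compl]
  exact this.isOpen_compl

lemma aux_compact_subset {Y X : Type*} [TopologicalSpace Y] [TopologicalSpace X] [T2Space X]
    (q : Y → X) (hq : IsQuotMap q) (K : CompactExhaustion Y) (L : Set X) (hL : IsCompact L) :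
    ∃ n, L ⊆ q '' K n := by
  by_contra! hcon
  have h1 : ∀ n, ∃ x ∈ L, x ∉ q '' K n := fun n => not_subset.1 (hcon n)
  choose x hxL hxn using h1
  have hcl : ∀ n, IsClosed (x '' Ici n) := by
    intro n
    refine aux_komega q hq K _ fun m => ?_
    refine (((finite_Iio m).image x).subset ?_).isClosed
    rintro _ ⟨⟨k, -, rfl⟩, hk⟩
    refine ⟨k, ?_, rfl⟩
    by_contra hkm
    exact hxn k (image_mono (K.subset (not_lt.1 hkm)) hk)
  have hsub : ∀ n, x '' Ici n ⊆ L := by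
    rintro n _ ⟨k, -, rfl⟩
    exact hxL k
  obtain ⟨p, hp⟩ := IsCompact.nonempty_iInter_of_sequence_nonempty_isCompact_isClosed
    (fun n => x '' Ici n) (fun n => image_mono (Ici_subset_Ici.2 n.le_succ))
    (fun n => ⟨x n, n, self_mem_Ici, rfl⟩) (hL.of_isClosed_subset (hcl 0) (hsub 0)) hcl
  obtain ⟨y, rfl⟩ := hq.1 p
  obtain ⟨m, hm⟩ := K.exists_mem y
  obtain ⟨k, hk, hky⟩ := mem_iInter.1 hp m
  exact hxn k (hky ▸ ⟨y, K.subset hk hm, rfl⟩)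

lemma aux_frechet {Y X : Type*} [MetricSpace Y] [TopologicalSpace X] [T2Space X]
    (q : Y → X) (hq : IsQuotMap q) (K : CompactExhaustion Y) (hk : ∀ x : X, IsKPoint x)
    (A : Set X) (x : X) (hx : x ∈ closure A) :
    ∃ u : ℕ → X, (∀ n, u n ∈ A) ∧ Filter.Tendsto u Filter.atTop (nhds x) := by
  obtain ⟨L, hL, hxL⟩ := hk x A hx
  obtain ⟨n, hn⟩ := aux_compact_subset q hq K L hL
  have hc : IsCompact (closure (q ⁻¹' A ∩ K n)) :=
    (K.isCompact n).of_isClosed_subset isClosed_closure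
      (closure_minimal inter_subset_right (K.isCompact n).isClosed)
  have h1 : A ∩ L ⊆ q '' closure (q ⁻¹' A ∩ K n) := by
    rintro a ⟨ha, haL⟩
    obtain ⟨z, hz, rfl⟩ := hn haL
    exact ⟨z, subset_closure ⟨ha, hz⟩, rfl⟩
  obtain ⟨z, hz, rfl⟩ := closure_minimal h1 (hc.image hq.2.1).isClosed hxL
  obtain ⟨u, hu, huz⟩ := mem_closure_iff_seq_limit.1 hz
  exact ⟨fun n => q (u n), fun n => (hu n).1, (hq.2.1.tendsto z).comp huz⟩

/-- the part of `X` first reached at level `n`. -/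
def auxU {Y X : Type*} [TopologicalSpace Y] (q : Y → X) (K : CompactExhaustion Y) (n : ℕ) :
    Set X := {x | x ∈ q '' K n ∧ ∀ k < n, x ∉ q '' K k}

section
variable {Y X : Type*} [TopologicalSpace Y] [TopologicalSpace X] [T2Space X]
    (q : Y → X) (hq : IsQuotMap q) (K : CompactExhaustion Y)

lemma aux_closureU_subset (hq : IsQuotMap q) (n : ℕ) : closure (auxU q K n) ⊆ q '' K n :=
  closure_minimal (fun _ hx => hx.1) ((K.isCompact n).image hq.2.1).isClosed

lemma aux_lev (hq : IsQuotMap q) (x : X) : ∃ n, x ∈ auxU q K n := by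
  classical
  have h : ∃ n, x ∈ q '' K n := by
    obtain ⟨y, rfl⟩ := hq.1 x
    obtain ⟨m, hm⟩ := K.exists_mem y
    exact ⟨m, y, hm, rfl⟩
  exact ⟨Nat.find h, Nat.find_spec h, fun k hk => Nat.find_min h hk⟩

lemma aux_mono {m n : ℕ} (h : m ≤ n) : q '' K m ⊆ q '' K n := image_mono (K.subset h)

lemma aux_closed (hq : IsQuotMap q) (hk : ∀ x : X, IsKPoint x) (F : ℕ → Set X)
    (hF : ∀ n, IsClosed (F n)) (hFU : ∀ n, F n ⊆ closure (auxU q K n)) :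
    IsClosed (⋃ n, F n) := by
  refine isClosed_of_closure_subset fun x hx => ?_
  by_contra hxF
  have hxn : ∀ n, x ∉ F n := fun n h => hxF (mem_iUnion.2 ⟨n, h⟩)
  obtain ⟨m, hm, -⟩ := aux_lev q K hq x
  have hFc : ∀ n, IsCompact (F n) := fun n =>
    ((K.isCompact n).image hq.2.1).of_isClosed_subset (hF n)
      ((hFU n).trans (aux_closureU_subset q K hq n))
  have hsep : ∀ n, ∃ O : Set X, IsOpen O ∧ F n ⊆ O ∧ x ∉ closure O := by
    intro n
    obtain ⟨O, V, hO, hV, hFO, hxV, hd⟩ :=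
      (hFc n).separation_of_notMem (hxn n)
    refine ⟨O, hO, hFO, fun hxc => ?_⟩
    obtain ⟨z, hz1, hz2⟩ := mem_closure_iff.1 hxc V hV hxV
    exact disjoint_left.1 hd hz2 hz1
  choose O hO hFO hxO using hsep
  let E : Set X := ⋃ n, ⋃ (_ : m < n), (auxU q K n ∩ O n)
  have hfin : IsClosed (⋃ n ∈ Iic m, F n) :=
    (finite_Iic m).isClosed_biUnion fun n _ => hF n
  have hxfin : x ∉ ⋃ n ∈ Iic m, F n := by
    simp [hxn]
  have hsub : (⋃ n, F n) ⊆ (⋃ n ∈ Iic m, F n) ∪ closure E := by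
    intro y hy
    obtain ⟨n, hn⟩ := mem_iUnion.1 hy
    by_cases hnm : n ≤ m
    · exact Or.inl (mem_biUnion (show n ∈ Iic m from hnm) hn)
    · right
      have h1 : y ∈ closure (auxU q K n ∩ O n) := by
        rw [mem_closure_iff]
        intro V hV hyV
        obtain ⟨z, hz, hz'⟩ := mem_closure_iff.1 (hFU n hn) (V ∩ O n) (hV.inter (hO n))
          ⟨hyV, hFO n hn⟩
        exact ⟨z, hz.1, hz', hz.2⟩
      refine closure_mono ?_ h1
      exact subset_iUnion₂_of_subset n (not_le.1 hnm) subset_rfl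
  have hxE : x ∈ closure E :=
    (closure_minimal hsub (hfin.union isClosed_closure) hx).resolve_left hxfin
  obtain ⟨L, hL, hxL⟩ := hk x E hxE
  obtain ⟨M, hM⟩ := aux_compact_subset q hq K L hL
  have hcl : IsClosed (⋃ n ∈ Iic M, closure (O n)) :=
    (finite_Iic M).isClosed_biUnion fun n _ => isClosed_closure
  have hsub2 : E ∩ L ⊆ ⋃ n ∈ Iic M, closure (O n) := by
    rintro y ⟨hy, hyL⟩
    simp only [E, mem_iUnion] at hy
    obtain ⟨n, hmn, hyU, hyO⟩ := hy
    refine mem_biUnion (show n ∈ Iic M from ?_) (subset_closure hyO)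
    by_contra hnM
    exact hyU.2 M (not_le.1 hnM) (hM hyL)
  have := closure_minimal hsub2 hcl hxL
  simp only [mem_iUnion] at this
  obtain ⟨n, -, h⟩ := this
  exact hxO n h

/-- points having only one preimage. -/
def auxG {Y X : Type*} [TopologicalSpace Y] [TopologicalSpace X] (q : Y → X)
    (K : CompactExhaustion Y) (n : ℕ) : Set X :=
  auxU q K n \ ⋃ k, ⋃ (_ : n < k), closure (auxU q K k)

lemma aux_tail_closed (hq : IsQuotMap q) (hk : ∀ x : X, IsKPoint x) (n : ℕ) :
    IsClosed (⋃ k, ⋃ (_ : n < k), closure (auxU q K k)) := by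
  refine aux_closed q K hq hk (fun k => ⋃ (_ : n < k), closure (auxU q K k)) ?_ ?_
  · intro k
    by_cases h : n < k <;> simp [h]
  · intro k
    simp

lemma aux_dense (hq : IsQuotMap q) (hk : ∀ x : X, IsKPoint x)
    (hfr : ∀ (A : Set X) (x : X), x ∈ closure A →
        ∃ u : ℕ → X, (∀ n, u n ∈ A) ∧ Filter.Tendsto u Filter.atTop (nhds x)) :
    Dense (⋃ n, auxG q K n) := by
  rw [dense_iff_inter_open]
  rintro O hO ⟨x, hxO⟩
  by_contra hcon
  have hnG : ∀ z ∈ O, ∀ n, z ∉ auxG q K n := fun z hz n hzn =>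
    hcon ⟨z, hz, mem_iUnion.2 ⟨n, hzn⟩⟩
  have hinf : ∀ z ∈ O, ∀ N : ℕ, ∃ m, N ≤ m ∧ z ∈ closure (auxU q K m) := by
    intro z hz N
    induction N with
    | zero =>
      obtain ⟨m, hm⟩ := aux_lev q K hq z
      exact ⟨m, Nat.zero_le _, subset_closure hm⟩
    | succ N ih =>
      obtain ⟨m, hNm, hm⟩ := ih
      by_contra! hno
      have hzT : z ∉ ⋃ k, ⋃ (_ : m < k), closure (auxU q K k) := by
        simp only [mem_iUnion, not_exists]
        intro k hk'
        exact hno k (by omega)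
      obtain ⟨y, ⟨hyO, hyT⟩, hyU⟩ := mem_closure_iff.1 hm _
        (hO.inter (aux_tail_closed q K hq hk m).isOpen_compl) ⟨hz, hzT⟩
      exact hnG y hyO m ⟨hyU, hyT⟩
  obtain ⟨l, hl⟩ := aux_lev q K hq x
  obtain ⟨m, hlm, hm⟩ := hinf x hxO (l + 1)
  have hxc : x ∈ closure (auxU q K m ∩ O) := by
    rw [mem_closure_iff]
    intro V hV hxV
    obtain ⟨z, hz, hz'⟩ := mem_closure_iff.1 hm (V ∩ O) (hV.inter hO) ⟨hxV, hxO⟩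
    exact ⟨z, hz.1, hz', hz.2⟩
  obtain ⟨z, hz, hzx⟩ := hfr _ _ hxc
  have hcl : IsClosed (⋃ n, (z '' Iic n) ∩ closure (auxU q K n)) := by
    refine aux_closed q K hq hk _ (fun n => ?_) (fun n => inter_subset_right)
    exact ((finite_Iic n).image z).isClosed.inter isClosed_closure
  have hmem : x ∈ ⋃ n, (z '' Iic n) ∩ closure (auxU q K n) := by
    refine hcl.mem_of_tendsto hzx (Eventually.of_forall fun j => ?_)
    obtain ⟨n, hjn, hn⟩ := hinf (z j) (hz j).2 j
    exact mem_iUnion.2 ⟨n, ⟨j, hjn, rfl⟩, hn⟩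
  obtain ⟨n, ⟨j, -, hj⟩, -⟩ := mem_iUnion.1 hmem
  have hxU : x ∈ auxU q K m := hj ▸ (hz j).1
  exact hxU.2 l (by omega) hl.1

end

lemma aux_main {Y : Type u} {X : Type v} [MetricSpace Y] [SeparableSpace Y]
    [TopologicalSpace X] [T2Space X]
    (q : Y → X) (hq : IsQuotMap q) (K : CompactExhaustion Y) (hk : ∀ x : X, IsKPoint x) :
    ∃ (Z : Type v) (_ : MetricSpace Z), LocallyCompactSpace Z ∧ SeparableSpace Z ∧
        ∃ p : Z → X, IsQuotMap p ∧ IsClosedMap p ∧ IsIrreducibleMap p := by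
  have hfr := aux_frechet q hq K hk
  haveI : SecondCountableTopology Y := UniformSpace.secondCountable_of_separable Y
  let C : ℕ → Set X := fun n => closure (auxG q K n)
  have hCU : ∀ n, C n ⊆ closure (auxU q K n) := fun n => closure_mono sdiff_subset
  have hCK : ∀ n, C n ⊆ q '' K n := fun n => (hCU n).trans (aux_closureU_subset q K hq n)
  have hCc : ∀ n, IsCompact (C n) := fun n =>
    ((K.isCompact n).image hq.2.1).of_isClosed_subset isClosed_closure (hCK n)
  haveI : ∀ n, CompactSpace (C n) := fun n => isCompact_iff_compactSpace.1 (hCc n)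
  haveI : ∀ n, SecondCountableTopology (C n) := by
    intro n
    let A : Set Y := K n ∩ q ⁻¹' (C n)
    have hA : IsCompact A := (K.isCompact n).inter_right (isClosed_closure.preimage hq.2.1)
    haveI : CompactSpace A := isCompact_iff_compactSpace.1 hA
    refine aux_secondCountable (fun a : A => (⟨q a, a.2.2⟩ : C n)) ?_ ?_
    · exact (hq.2.1.comp continuous_subtype_val).subtype_mk _
    · rintro ⟨x, hx⟩
      obtain ⟨y, hy, rfl⟩ := hCK n hx
      exact ⟨⟨y, hy, hx⟩, rfl⟩
  let Z := Σ n, C n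
  haveI : WeaklyLocallyCompactSpace Z := by
    refine ⟨fun z => ⟨range (Sigma.mk z.1), isCompact_range continuous_sigmaMk, ?_⟩⟩
    exact isOpen_range_sigmaMk.mem_nhds ⟨z.2, rfl⟩
  haveI : LocallyCompactSpace Z := inferInstance
  haveI : MetrizableSpace Z := metrizableSpace_of_t3_secondCountable Z
  let mk : ∀ n, C n → Z := fun n x => ⟨n, x⟩
  let p : Z → X := fun z => z.2
  have hpc : Continuous p := continuous_sigma fun n => continuous_subtype_val
  have himg : ∀ V : Set Z, p '' V = ⋃ n, (Subtype.val '' (mk n ⁻¹' V) : Set X) := by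
    intro V
    ext x
    simp only [mem_iUnion]
    constructor
    · rintro ⟨⟨n, y⟩, hV, rfl⟩
      exact ⟨n, y, hV, rfl⟩
    · rintro ⟨n, y, hV, rfl⟩
      exact ⟨⟨n, y⟩, hV, rfl⟩
  have hclV : ∀ V : Set Z, IsClosed V → ∀ n,
      IsClosed (Subtype.val '' (mk n ⁻¹' V) : Set X) := by
    intro V hV n
    exact isClosed_closure.isClosedMap_subtype_val _ (isClosed_sigma_iff.1 hV n)
  have hpcl : IsClosedMap p := by
    intro V hV
    rw [himg]
    refine aux_closed q K hq hk _ (hclV V hV) ?_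
    rintro n _ ⟨y, -, rfl⟩
    exact hCU n y.2
  have hps : Function.Surjective p := by
    have h1 : IsClosed (range p) := hpcl.isClosed_range
    have h2 : (⋃ n, auxG q K n) ⊆ range p := by
      intro x hx
      obtain ⟨n, hn⟩ := mem_iUnion.1 hx
      exact ⟨⟨n, ⟨x, subset_closure hn⟩⟩, rfl⟩
    intro x
    exact closure_minimal h2 h1 (aux_dense q K hq hk hfr x)
  refine ⟨Z, metrizableSpaceMetric Z, inferInstance, inferInstance, p, ⟨hps, hpc, ?_⟩, hpcl, ?_⟩
  · intro s
    exact ((hpcl.isQuotientMap hpc hps).isOpen_preimage).symm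
  · intro V hV hVu
    rw [eq_univ_iff_forall]
    rintro ⟨n, x, hx⟩
    have hsub : auxG q K n ⊆ (Subtype.val '' (mk n ⁻¹' V) : Set X) := by
      intro y hy
      have hyV : y ∈ p '' V := hVu ▸ mem_univ y
      rw [himg] at hyV
      obtain ⟨k, hk'⟩ := mem_iUnion.1 hyV
      have hyC : y ∈ C k := by
        obtain ⟨w, -, rfl⟩ := hk'
        exact w.2
      rcases lt_trichotomy k n with h | h | h
      · exact absurd (hCK k hyC) (hy.1.2 k h)
      · subst h
        exact hk'
      · exact absurd (mem_iUnion₂.2 ⟨k, h, hCU k hyC⟩) hy.2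
    obtain ⟨w, hw, hwx⟩ := closure_minimal hsub (hclV V hV n) hx
    have : w = ⟨x, hx⟩ := Subtype.ext hwx
    subst this
    exact hw

theorem statement_2 {Y : Type u} {X : Type v} [MetricSpace Y] [LocallyCompactSpace Y]
    [SeparableSpace Y] [TopologicalSpace X] [T2Space X]
    (q : Y → X) (hq : IsPureQuotMap.{u, v, w} q) :
    ((∀ x : X, IsKPoint x) ↔
      (∀ (A : Set X) (x : X), x ∈ closure A →
        ∃ u : ℕ → X, (∀ n, u n ∈ A) ∧ Filter.Tendsto u Filter.atTop (nhds x))) ∧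
    ((∀ x : X, IsKPoint x) ↔
      (∃ (Z : Type v) (_ : MetricSpace Z), LocallyCompactSpace Z ∧ SeparableSpace Z ∧
        ∃ p : Z → X, IsQuotMap p ∧ IsClosedMap p)) ∧
    ((∀ x : X, IsKPoint x) ↔
      (∃ (Z : Type v) (_ : MetricSpace Z), LocallyCompactSpace Z ∧ SeparableSpace Z ∧
        ∃ p : Z → X, IsQuotMap p ∧ IsClosedMap p ∧ IsIrreducibleMap p)) := by
  haveI : SecondCountableTopology Y := UniformSpace.secondCountable_of_separable Y
  have K : CompactExhaustion Y := CompactExhaustion.choice Y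
  have hq' := hq.1
  refine ⟨⟨fun hk => aux_frechet q hq' K hk, aux_kpoint_of_frechet⟩, ⟨fun hk => ?_, ?_⟩,
    ⟨fun hk => aux_main q hq' K hk, ?_⟩⟩
  · obtain ⟨Z, m, h1, h2, p, h3, h4, -⟩ := aux_main q hq' K hk
    exact ⟨Z, m, h1, h2, p, h3, h4⟩
  · rintro ⟨Z, m, -, -, p, h3, h4⟩
    exact aux_kpoint_of_frechet (aux_frechet_of_closed p h3 h4)
  · rintro ⟨Z, m, -, -, p, h3, h4, -⟩
    exact aux_kpoint_of_frechet (aux_frechet_of_closed p h3 h4)
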